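/- Let q ∈ (1/2, 1), ε ∈ (0, q - 1/2), ρ ∈ (0, 1/2], and let N ≥ 1 be an integer. For each i ∈ {1,…,N} let m_i ≥ 1 be an integer, (Ω_i, μ_i) a probability space, and A_i : {0,1}^{m_i} × Ω_i → {0,1} a measurable map. Assume: (i) (replicability) if p_1,…,p_N are i.i.d. Uniform[q-ε, q], and conditionally on the p_i's, for each i the sequences x_i and x'_i are two independent samples from Ber(p_i)^{m_i} (independent across i), and independently r_i ~ μ_i (independent across i and of the samples), then P[A_i(x_i; r_i) = A_i(x'_i; r_i) for every i ∈ {1,…,N}] ≥ 1 - ρ; (ii) (correctness) for every i and every p ∈ {q-ε, q}, if x ~ Ber(p)^{m_i} and independently r ~ μ_i, then A_i(x; r) equals the indicator of p = q with probability at least 23/24. Then Σ_{i=1}^N m_i ≥ (2/6561) · N³ q(1-q) / (ε² ρ²). -/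

import Mathlib

open MeasureTheory Finset

/-- The Bernoulli measure on `Bool` with probability `p` of `true`. -/
noncomputable def bern (p : ℝ) : Measure Bool :=
  ENNReal.ofReal p • Measure.dirac true + ENNReal.ofReal (1 - p) • Measure.dirac false

/-- The law of `m` i.i.d. `Ber(p)` coin flips: the product measure `Ber(p)^m`. -/
noncomputable def coinSeq (m : ℕ) (p : ℝ) : Measure (Fin m → Bool) :=
  Measure.pi fun _ => bern p

/-- The uniform probability measure on the interval `[a, b]`. -/
noncomputable def unifIcc (a b : ℝ) : Measure ℝ :=
  (ENNReal.ofReal (b - a))⁻¹ • volume.restrict (Set.Icc a b)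

/-- The probability `Ber(p)` gives to the outcome `b`, as a polynomial in `p`. -/
def bernWeight (p : ℝ) (b : Bool) : ℝ := if b then p else 1 - p

/-- The score (logarithmic derivative in `p`) of `Ber(p)` at the outcome `b`. -/
noncomputable def bernScore (p : ℝ) (b : Bool) : ℝ := if b then p⁻¹ else -(1 - p)⁻¹

/-- The probability `Ber(p)^m` gives to the sequence `x`, as a polynomial in `p`. -/
def seqWeight {m : ℕ} (p : ℝ) (x : Fin m → Bool) : ℝ := ∏ j, bernWeight p (x j)

/-- The score of `Ber(p)^m` at the sequence `x`. -/
noncomputable def seqScore {m : ℕ} (p : ℝ) (x : Fin m → Bool) : ℝ := ∑ j, bernScore p (x j)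

/-- The probability that the test `a` accepts a `Ber(p)^m` sample, as a polynomial in `p`. -/
def acceptProb {m : ℕ} (a : (Fin m → Bool) → Bool) (p : ℝ) : ℝ :=
  ∑ x, if a x then seqWeight p x else 0

lemma seqWeight_nonneg {m : ℕ} {p : ℝ} (hp : p ∈ Set.Icc (0 : ℝ) 1) (x : Fin m → Bool) :
    0 ≤ seqWeight p x := by
  refine Finset.prod_nonneg fun j _ => ?_
  unfold bernWeight
  split_ifs
  · exact hp.1
  · linarith [hp.2]

lemma sum_fin_succ_bool {m : ℕ} (F : (Fin (m + 1) → Bool) → ℝ) :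
    ∑ x, F x = ∑ y : Fin m → Bool, (F (Fin.cons true y) + F (Fin.cons false y)) := by
  rw [← (Fin.consEquiv fun _ : Fin (m + 1) => Bool).sum_comp, Fintype.sum_prod_type,
    Fintype.sum_bool, ← Finset.sum_add_distrib]
  rfl

lemma seqWeight_cons {m : ℕ} (p : ℝ) (b : Bool) (y : Fin m → Bool) :
    seqWeight p (Fin.cons b y : Fin (m + 1) → Bool) = bernWeight p b * seqWeight p y := by
  simp [seqWeight, Fin.prod_univ_succ]

lemma seqScore_cons {m : ℕ} (p : ℝ) (b : Bool) (y : Fin m → Bool) :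
    seqScore p (Fin.cons b y : Fin (m + 1) → Bool) = bernScore p b + seqScore p y := by
  simp [seqScore, Fin.sum_univ_succ]

lemma sum_seqWeight (m : ℕ) (p : ℝ) : ∑ x : Fin m → Bool, seqWeight p x = 1 := by
  induction m with
  | zero => simp [seqWeight]
  | succ m ih =>
    rw [sum_fin_succ_bool, ← ih]
    refine Finset.sum_congr rfl fun y _ => ?_
    simp only [seqWeight_cons, bernWeight]
    simp
    ring

lemma sum_seqWeight_mul_score (m : ℕ) {p : ℝ} (hp : p ∈ Set.Ioo (0 : ℝ) 1) :
    ∑ x : Fin m → Bool, seqWeight p x * seqScore p x = 0 := by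
  have h0 : p ≠ 0 := hp.1.ne'
  have h1 : 1 - p ≠ 0 := by linarith [hp.2]
  induction m with
  | zero => simp [seqScore]
  | succ m ih =>
    rw [sum_fin_succ_bool, ← ih]
    refine Finset.sum_congr rfl fun y _ => ?_
    simp only [seqWeight_cons, seqScore_cons, bernWeight, bernScore]
    simp
    field_simp
    ring

lemma sum_seqWeight_mul_score_sq (m : ℕ) {p : ℝ} (hp : p ∈ Set.Ioo (0 : ℝ) 1) :
    ∑ x : Fin m → Bool, seqWeight p x * seqScore p x ^ 2 = m / (p * (1 - p)) := by
  have h0 : p ≠ 0 := hp.1.ne'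
  have h1 : 1 - p ≠ 0 := by linarith [hp.2]
  induction m with
  | zero => simp [seqScore]
  | succ m ih =>
    have key : ∑ x : Fin (m + 1) → Bool, seqWeight p x * seqScore p x ^ 2 =
        ∑ y : Fin m → Bool, (seqWeight p y * seqScore p y ^ 2 +
          (p * (1 - p))⁻¹ * seqWeight p y) := by
      rw [sum_fin_succ_bool]
      refine Finset.sum_congr rfl fun y _ => ?_
      simp only [seqWeight_cons, seqScore_cons, bernWeight, bernScore]
      simp
      field_simp
      ring
    rw [key, Finset.sum_add_distrib, ih, ← Finset.mul_sum, sum_seqWeight]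
    push_cast
    field_simp

lemma hasDerivAt_seqWeight {m : ℕ} {p : ℝ} (hp : p ∈ Set.Ioo (0 : ℝ) 1) (x : Fin m → Bool) :
    HasDerivAt (fun p => seqWeight p x) (seqWeight p x * seqScore p x) p := by
  have h0 : p ≠ 0 := hp.1.ne'
  have h1 : 1 - p ≠ 0 := by linarith [hp.2]
  unfold seqWeight seqScore
  induction (Finset.univ : Finset (Fin m)) using Finset.induction_on with
  | empty => simpa using hasDerivAt_const p (1 : ℝ)
  | insert j s hj ih =>
    simp only [Finset.prod_insert hj, Finset.sum_insert hj]
    have hb : HasDerivAt (fun p => bernWeight p (x j))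
        (bernWeight p (x j) * bernScore p (x j)) p := by
      cases x j
      · simpa [bernWeight, bernScore, h1] using (hasDerivAt_id' p).const_sub 1
      · simpa [bernWeight, bernScore, h0] using hasDerivAt_id' p
    exact (hb.fun_mul ih).congr_deriv (by ring)

lemma hasDerivAt_acceptProb {m : ℕ} (a : (Fin m → Bool) → Bool) {p : ℝ}
    (hp : p ∈ Set.Ioo (0 : ℝ) 1) :
    HasDerivAt (acceptProb a)
      (∑ x, if a x then seqWeight p x * seqScore p x else 0) p := by
  unfold acceptProb
  refine HasDerivAt.fun_sum fun x _ => ?_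
  split_ifs
  · exact hasDerivAt_seqWeight hp x
  · exact hasDerivAt_const p 0

lemma acceptProb_nonneg {m : ℕ} (a : (Fin m → Bool) → Bool) {p : ℝ}
    (hp : p ∈ Set.Icc (0 : ℝ) 1) : 0 ≤ acceptProb a p :=
  Finset.sum_nonneg fun x _ => by split_ifs <;> simp [seqWeight_nonneg hp]

lemma acceptProb_le_one {m : ℕ} (a : (Fin m → Bool) → Bool) {p : ℝ}
    (hp : p ∈ Set.Icc (0 : ℝ) 1) : acceptProb a p ≤ 1 := by
  rw [← sum_seqWeight m p]
  exact Finset.sum_le_sum fun x _ => by split_ifs <;> simp [seqWeight_nonneg hp]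

lemma continuous_acceptProb {m : ℕ} (a : (Fin m → Bool) → Bool) : Continuous (acceptProb a) := by
  unfold acceptProb seqWeight bernWeight
  refine continuous_finsetSum _ fun x _ => ?_
  split_ifs
  · refine continuous_finsetProd _ fun j _ => ?_
    split_ifs <;> fun_prop
  · fun_prop

lemma deriv_acceptProb_sq_le {m : ℕ} (a : (Fin m → Bool) → Bool) {p : ℝ}
    (hp : p ∈ Set.Ioo (0 : ℝ) 1) :
    (∑ x, if a x then seqWeight p x * seqScore p x else 0) ^ 2 ≤ m / (p * (1 - p)) := by
  have hw := fun x : Fin m → Bool => seqWeight_nonneg (Set.Ioo_subset_Icc_self hp) x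
  have hcs := Finset.sum_sq_le_sum_mul_sum_of_sq_le_mul (Finset.univ : Finset (Fin m → Bool))
    (r := fun x => if a x then seqWeight p x * seqScore p x else 0)
    (f := fun x => if a x then seqWeight p x else 0)
    (g := fun x => seqWeight p x * seqScore p x ^ 2)
    (fun x _ => by split_ifs <;> simp [hw x])
    (fun x _ => mul_nonneg (hw x) (sq_nonneg _))
    (fun x _ => by split_ifs <;> nlinarith)
  rw [sum_seqWeight_mul_score_sq m hp] at hcs
  refine hcs.trans (mul_le_of_le_one_left ?_ (acceptProb_le_one a (Set.Ioo_subset_Icc_self hp)))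
  have h1 : 0 < 1 - p := by linarith [hp.2]
  have := hp.1
  positivity

/-- A test whose acceptance probability climbs from near `0` to near `1` on `[q - ε, q]` has
large average variance there. -/
lemma le_integral_acceptProb_variance {q ε : ℝ} (hq : q ∈ Set.Ioo (1 / 2 : ℝ) 1)
    (hε : ε ∈ Set.Ioo (0 : ℝ) (q - 1 / 2)) {m : ℕ} (hm : 1 ≤ m)
    (a : (Fin m → Bool) → Bool) :
    √(q * (1 - q) / m) *
        (1 / 6 - (1 - acceptProb a q) / 4 - acceptProb a (q - ε) / 4) ≤
      ∫ p in (q - ε)..q, acceptProb a p * (1 - acceptProb a p) := by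
  obtain ⟨hq0, hq1⟩ := hq
  obtain ⟨hε0, hε1⟩ := hε
  set f := acceptProb a with hf
  let f' : ℝ → ℝ := fun p => ∑ x, if a x then seqWeight p x * seqScore p x else 0
  have hcont : Continuous f := continuous_acceptProb a
  set s := √(q * (1 - q) / m) with hs
  have hmpos : (0 : ℝ) < m := by exact_mod_cast hm
  have hq2 : 0 < q * (1 - q) := mul_pos (by linarith) (by linarith)
  have hle : q - ε ≤ q := by linarith
  have hmem : ∀ p ∈ Set.Icc (q - ε) q, p ∈ Set.Ioo (0 : ℝ) 1 := fun p hp =>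
    ⟨by linarith [hp.1], by linarith [hp.2]⟩
  have hslope : ∀ p ∈ Set.Icc (q - ε) q, s * f' p ≤ 1 := by
    intro p hp
    have hd := deriv_acceptProb_sq_le a (hmem p hp)
    have hpq : q * (1 - q) ≤ p * (1 - p) := by nlinarith [hp.1, hp.2]
    refine (abs_le_one_iff_mul_self_le_one.2 ?_ |> (le_abs_self _).trans)
    calc s * f' p * (s * f' p) = s ^ 2 * f' p ^ 2 := by ring
      _ ≤ (q * (1 - q) / m) * (m / (q * (1 - q))) := by
          rw [hs, Real.sq_sqrt (by positivity)]
          gcongr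
          exact hd.trans (by gcongr)
      _ = 1 := by field_simp
  have hderiv : ∀ p ∈ Set.uIcc (q - ε) q,
      HasDerivAt (fun p => s * (f p ^ 2 / 2 - f p ^ 3 / 3))
        (f p * (1 - f p) * (s * f' p)) p := by
    intro p hp
    rw [Set.uIcc_of_le hle] at hp
    have h : HasDerivAt f (f' p) p := hasDerivAt_acceptProb a (hmem p hp)
    refine ((((h.fun_pow 2).div_const 2).fun_sub ((h.fun_pow 3).div_const 3)).const_mul
      s).congr_deriv ?_
    push_cast
    ring
  have hf'cont : ContinuousOn f' (Set.uIcc (q - ε) q) := by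
    rw [Set.uIcc_of_le hle]
    refine continuousOn_finsetSum _ fun x _ => ?_
    split_ifs
    · intro p hp
      refine ContinuousAt.continuousWithinAt ?_
      refine (hasDerivAt_seqWeight (hmem p hp) x).continuousAt.mul ?_
      refine tendsto_finsetSum _ fun j _ => ?_
      have h0 : p ≠ 0 := (hmem p hp).1.ne'
      have h1 : 1 - p ≠ 0 := by linarith [(hmem p hp).2]
      unfold bernScore
      split_ifs
      · exact continuousAt_inv₀ h0
      · exact ((continuousAt_const.sub continuousAt_id).inv₀ h1).neg
    · exact continuousOn_const
  have hint : IntervalIntegrable (fun p => f p * (1 - f p) * (s * f' p)) volume (q - ε) q :=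
    ContinuousOn.intervalIntegrable
      ((hcont.mul (continuous_const.sub hcont)).continuousOn.mul
        (continuousOn_const.mul hf'cont))
  have hftc := intervalIntegral.integral_eq_sub_of_hasDerivAt hderiv hint
  have hmono : ∫ p in (q - ε)..q, f p * (1 - f p) * (s * f' p) ≤
      ∫ p in (q - ε)..q, f p * (1 - f p) := by
    refine intervalIntegral.integral_mono_on hle hint
      ((hcont.mul (continuous_const.sub hcont)).intervalIntegrable _ _) fun p hp => ?_
    have hpI := Set.Ioo_subset_Icc_self (hmem p hp)
    exact mul_le_of_le_one_right (mul_nonneg (acceptProb_nonneg a hpI)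
      (sub_nonneg.2 (acceptProb_le_one a hpI))) (hslope p hp)
  rw [hftc] at hmono
  refine le_trans ?_ hmono
  rw [← mul_sub]
  refine mul_le_mul_of_nonneg_left ?_ (Real.sqrt_nonneg _)
  have hqI := Set.Ioo_subset_Icc_self (hmem q ⟨hle, le_rfl⟩)
  have hqεI := Set.Ioo_subset_Icc_self (hmem (q - ε) ⟨le_rfl, hle⟩)
  have u0 : 0 ≤ f q := acceptProb_nonneg a hqI
  have u1 : f q ≤ 1 := acceptProb_le_one a hqI
  have v0 : 0 ≤ f (q - ε) := acceptProb_nonneg a hqεI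
  have v1 : f (q - ε) ≤ 1 := acceptProb_le_one a hqεI
  have hu : 1 / 6 - (1 - f q) / 4 ≤ f q ^ 2 / 2 - f q ^ 3 / 3 := by
    nlinarith [mul_nonneg (sub_nonneg.2 u1) (sq_nonneg (f q - 1 / 4))]
  have hv : f (q - ε) ^ 2 / 2 - f (q - ε) ^ 3 / 3 ≤ f (q - ε) / 4 := by
    nlinarith [mul_nonneg v0 (sq_nonneg (f (q - ε) - 3 / 4))]
  linarith

instance isFiniteMeasure_bern (p : ℝ) : IsFiniteMeasure (bern p) := by
  refine ⟨?_⟩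
  simp [bern]

instance isFiniteMeasure_coinSeq (m : ℕ) (p : ℝ) : IsFiniteMeasure (coinSeq m p) := by
  unfold coinSeq
  infer_instance

instance isFiniteMeasure_unifIcc (a b : ℝ) : IsFiniteMeasure (unifIcc a b) := by
  refine ⟨?_⟩
  rw [unifIcc, Measure.smul_apply, Measure.restrict_apply_univ, Real.volume_Icc, smul_eq_mul]
  rcases eq_or_ne (ENNReal.ofReal (b - a)) 0 with h | h
  · simp [h]
  · exact ENNReal.mul_lt_top (by simpa [pos_iff_ne_zero] using h) ENNReal.ofReal_lt_top

lemma coinSeq_real_singleton {m : ℕ} {p : ℝ} (hp : p ∈ Set.Icc (0 : ℝ) 1) (x : Fin m → Bool) :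
    (coinSeq m p).real {x} = seqWeight p x := by
  rw [coinSeq, measureReal_def, Measure.pi_singleton, ENNReal.toReal_prod, seqWeight]
  refine Finset.prod_congr rfl fun j _ => ?_
  have h1 : 0 ≤ 1 - p := by linarith [hp.2]
  cases x j <;> simp [bern, bernWeight, hp.1, h1]

lemma coinSeq_real_accept {m : ℕ} {p : ℝ} (hp : p ∈ Set.Icc (0 : ℝ) 1)
    (a : (Fin m → Bool) → Bool) : (coinSeq m p).real {x | a x = true} = acceptProb a p := by
  have h := sum_measureReal_singleton (μ := coinSeq m p) (Finset.univ.filter fun x => a x = true)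
  rw [Finset.coe_filter] at h
  simp only [Finset.mem_univ, true_and] at h
  rw [← h, Finset.sum_filter, acceptProb]
  simp only [coinSeq_real_singleton hp]

lemma isProbabilityMeasure_coinSeq (m : ℕ) {p : ℝ} (hp : p ∈ Set.Icc (0 : ℝ) 1) :
    IsProbabilityMeasure (coinSeq m p) := by
  have : IsProbabilityMeasure (bern p) := by
    refine ⟨?_⟩
    simp only [bern, Measure.add_apply, Measure.smul_apply, measure_univ, smul_eq_mul, mul_one]
    rw [← ENNReal.ofReal_add hp.1 (by linarith [hp.2])]
    simp
  unfold coinSeq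
  infer_instance

lemma coinSeq_real_reject {m : ℕ} {p : ℝ} (hp : p ∈ Set.Icc (0 : ℝ) 1)
    (a : (Fin m → Bool) → Bool) :
    (coinSeq m p).real {x | a x = false} = 1 - acceptProb a p := by
  have := isProbabilityMeasure_coinSeq m hp
  rw [← coinSeq_real_accept hp, ← probReal_compl_eq_one_sub (Set.toFinite _).measurableSet]
  congr 1
  ext x
  simp

lemma coinSeq_prod_real_agree {m : ℕ} {p : ℝ} (hp : p ∈ Set.Icc (0 : ℝ) 1)
    (a : (Fin m → Bool) → Bool) :
    ((coinSeq m p).prod (coinSeq m p)).real {x | a x.1 = a x.2} =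
      1 - 2 * (acceptProb a p * (1 - acceptProb a p)) := by
  have hset : {x : (Fin m → Bool) × (Fin m → Bool) | a x.1 = a x.2} =
      {x | a x = true} ×ˢ {x | a x = true} ∪ {x | a x = false} ×ˢ {x | a x = false} := by
    ext x
    simp only [Set.mem_ofPred_eq, Set.mem_union, Set.mem_prod]
    cases a x.1 <;> cases a x.2 <;> simp
  have hdisj : Disjoint ({x | a x = true} ×ˢ {x | a x = true})
      ({x | a x = false} ×ˢ {x | a x = false}) := by
    rw [Set.disjoint_left]
    rintro x ⟨h, -⟩ ⟨h', -⟩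
    simp_all
  rw [hset, measureReal_union hdisj (Set.toFinite _).measurableSet, measureReal_prod_prod,
    measureReal_prod_prod, coinSeq_real_accept hp, coinSeq_real_reject hp]
  ring

/-- Conditioning a product measure on a finitely valued function of the second coordinate. -/
lemma prod_real_eq_sum_fiber {X Ω T : Type*} [MeasurableSpace X] [MeasurableSpace Ω]
    [MeasurableSpace T] [MeasurableSingletonClass T] [Fintype T] (D : Measure X)
    [IsFiniteMeasure D] (μ : Measure Ω) [IsFiniteMeasure μ] {B : Ω → T} (hB : Measurable B)
    (Φ : X → T → Prop) (hΦ : ∀ a, MeasurableSet {x | Φ x a}) :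
    (D.prod μ).real {w | Φ w.1 (B w.2)} = ∑ a, μ.real (B ⁻¹' {a}) * D.real {x | Φ x a} := by
  have hset : {w : X × Ω | Φ w.1 (B w.2)} =
      ⋃ a ∈ (Finset.univ : Finset T), {x | Φ x a} ×ˢ (B ⁻¹' {a}) := by
    ext w
    simp
  rw [hset, measureReal_biUnion_finset]
  · simp only [measureReal_prod_prod, mul_comm]
  · intro a _ b _ hab
    rw [Function.onFun, Set.disjoint_left]
    rintro w ⟨-, h⟩ ⟨-, h'⟩
    exact hab (h.symm.trans h')
  · exact fun a _ => (hΦ a).prod (hB (measurableSet_singleton a))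

lemma integral_unifIcc {a b : ℝ} (hab : a < b) (F : ℝ → ℝ) :
    ∫ p, F p ∂(unifIcc a b) = (b - a)⁻¹ * ∫ p in a..b, F p := by
  rw [unifIcc, integral_smul_measure, integral_Icc_eq_integral_Ioc,
    intervalIntegral.integral_of_le hab.le, ENNReal.toReal_inv,
    ENNReal.toReal_ofReal (by linarith), smul_eq_mul]

/-- The average agreement probability of two executions of an accurate test on a single coin. -/
lemma integral_agree_le {q ε : ℝ} (hq : q ∈ Set.Ioo (1 / 2 : ℝ) 1)
    (hε : ε ∈ Set.Ioo (0 : ℝ) (q - 1 / 2)) {m : ℕ} (hm : 1 ≤ m) {Ω : Type*}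
    [MeasurableSpace Ω] (μ : Measure Ω) [IsProbabilityMeasure μ]
    {A : (Fin m → Bool) × Ω → Bool} (hA : Measurable A)
    (h0 : 23 / 24 ≤ ((coinSeq m (q - ε)).prod μ).real {w | A w = false})
    (h1 : 23 / 24 ≤ ((coinSeq m q).prod μ).real {w | A w = true}) :
    ∫ p, (((coinSeq m p).prod (coinSeq m p)).prod μ).real
        {w | A (w.1.1, w.2) = A (w.1.2, w.2)} ∂(unifIcc (q - ε) q) ≤
      1 - 7 / 24 * (√(q * (1 - q) / m) / ε) := by
  let B : Ω → (Fin m → Bool) → Bool := fun r x => A (x, r)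
  have hB : Measurable B := measurable_pi_lambda _ fun x => hA.comp measurable_prodMk_left
  let v : ((Fin m → Bool) → Bool) → ℝ := fun a => μ.real (B ⁻¹' {a})
  have hv0 : ∀ a, 0 ≤ v a := fun a => measureReal_nonneg
  have hv1 : ∑ a, v a = 1 := by
    have := sum_measureReal_preimage_singleton (μ := μ) Finset.univ
      fun a _ => hB (measurableSet_singleton a)
    simpa using this
  have hε0 := hε.1
  have hIcc : ∀ p ∈ Set.Icc (q - ε) q, p ∈ Set.Icc (0 : ℝ) 1 := fun p hp =>
    ⟨by linarith [hp.1, hε.2, hq.1], by linarith [hp.2, hq.2]⟩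
  have hle : q - ε ≤ q := by linarith
  have hagree : ∀ p ∈ Set.Icc (q - ε) q, (((coinSeq m p).prod (coinSeq m p)).prod μ).real
      {w | A (w.1.1, w.2) = A (w.1.2, w.2)} =
      1 - 2 * ∑ a, v a * (acceptProb a p * (1 - acceptProb a p)) := by
    intro p hp
    have h := prod_real_eq_sum_fiber ((coinSeq m p).prod (coinSeq m p)) μ hB
      (fun x a => a x.1 = a x.2) fun a => (Set.toFinite _).measurableSet
    refine h.trans ?_
    nth_rw 1 [← hv1]
    rw [Finset.mul_sum, ← Finset.sum_sub_distrib]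
    refine Finset.sum_congr rfl fun a _ => ?_
    rw [coinSeq_prod_real_agree (hIcc p hp)]
    ring
  have hacc : 23 / 24 ≤ ∑ a, v a * acceptProb a q := by
    have h := prod_real_eq_sum_fiber (coinSeq m q) μ hB
      (fun x a => a x = true) fun a => (Set.toFinite _).measurableSet
    simp only [coinSeq_real_accept (hIcc q ⟨hle, le_rfl⟩)] at h
    exact h1.trans_eq h
  have hrej : ∑ a, v a * acceptProb a (q - ε) ≤ 1 / 24 := by
    have h := prod_real_eq_sum_fiber (coinSeq m (q - ε)) μ hB
      (fun x a => a x = false) fun a => (Set.toFinite _).measurableSet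
    simp only [coinSeq_real_reject (hIcc (q - ε) ⟨le_rfl, hle⟩), mul_sub, mul_one,
      Finset.sum_sub_distrib] at h
    have := h0.trans_eq h
    change 23 / 24 ≤ ∑ a, v a - ∑ a, v a * acceptProb a (q - ε) at this
    linarith
  set s := √(q * (1 - q) / m)
  have hvar : s * (7 / 48) ≤
      ∑ a, v a * ∫ p in (q - ε)..q, acceptProb a p * (1 - acceptProb a p) := by
    calc s * (7 / 48)
        ≤ s * (1 / 6 - (1 - ∑ a, v a * acceptProb a q) / 4
            - (∑ a, v a * acceptProb a (q - ε)) / 4) :=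
          mul_le_mul_of_nonneg_left (by linarith) (Real.sqrt_nonneg _)
      _ = ∑ a, v a * (s * (1 / 6 - (1 - acceptProb a q) / 4 - acceptProb a (q - ε) / 4)) := by
          have : ∀ a, v a * (s * (1 / 6 - (1 - acceptProb a q) / 4 - acceptProb a (q - ε) / 4)) =
              s * (-(1 / 12) * v a + 1 / 4 * (v a * acceptProb a q) -
                1 / 4 * (v a * acceptProb a (q - ε))) := fun a => by ring
          simp only [this, ← Finset.mul_sum, Finset.sum_sub_distrib, Finset.sum_add_distrib, hv1]
          ring
      _ ≤ _ := Finset.sum_le_sum fun a _ =>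
          mul_le_mul_of_nonneg_left (le_integral_acceptProb_variance hq hε hm a) (hv0 a)
  have hcont : ∀ a : (Fin m → Bool) → Bool,
      Continuous fun p => v a * (acceptProb a p * (1 - acceptProb a p)) := fun a =>
    continuous_const.mul ((continuous_acceptProb a).mul
      (continuous_const.sub (continuous_acceptProb a)))
  have hcont2 : Continuous fun p => 2 * ∑ a, v a * (acceptProb a p * (1 - acceptProb a p)) :=
    continuous_const.mul (continuous_finsetSum _ fun a _ => hcont a)
  have hint : ∫ p in (q - ε)..q, (((coinSeq m p).prod (coinSeq m p)).prod μ).real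
      {w | A (w.1.1, w.2) = A (w.1.2, w.2)} =
      ε - 2 * ∑ a, v a * ∫ p in (q - ε)..q, acceptProb a p * (1 - acceptProb a p) := by
    rw [intervalIntegral.integral_congr fun p hp => hagree p (by rwa [Set.uIcc_of_le hle] at hp),
      intervalIntegral.integral_sub intervalIntegrable_const (hcont2.intervalIntegrable _ _),
      intervalIntegral.integral_const_mul, intervalIntegral.integral_finsetSum
        fun a _ => (hcont a).intervalIntegrable _ _]
    simp only [intervalIntegral.integral_const_mul, intervalIntegral.integral_const]
    simp
  rw [integral_unifIcc (by linarith), hint, sub_sub_cancel]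
  have : 1 - 7 / 24 * (s / ε) = ε⁻¹ * (ε - 2 * (s * (7 / 48))) := by
    field_simp
    ring
  rw [this]
  gcongr

/-- If the factors `κ i ≤ 1 - d i` have product at least `1 - ρ`, then `∑ d i ≤ 2 ρ`. -/
lemma sum_le_of_one_sub_le_prod {ι : Type*} (t : Finset ι) {κ d : ι → ℝ} {ρ : ℝ}
    (hρ : ρ ∈ Set.Ioc (0 : ℝ) (1 / 2)) (hκ : ∀ i, 0 ≤ κ i) (hd : ∀ i, κ i ≤ 1 - d i)
    (h : 1 - ρ ≤ ∏ i ∈ t, κ i) : ∑ i ∈ t, d i ≤ 2 * ρ := by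
  obtain ⟨hρ0, hρ1⟩ := hρ
  have hpos : 0 < 1 - ρ := by linarith
  have hexp : 1 - ρ ≤ Real.exp (-∑ i ∈ t, d i) := by
    rw [← Finset.sum_neg_distrib, Real.exp_sum]
    refine h.trans (Finset.prod_le_prod (fun i _ => hκ i) fun i _ => (hd i).trans ?_)
    linarith [Real.add_one_le_exp (-d i)]
  have h1 : Real.log (1 - ρ) ≤ -∑ i ∈ t, d i := (Real.log_le_iff_le_exp hpos).2 hexp
  have h2 := Real.one_sub_inv_le_log_of_pos hpos
  have h3 : (1 - ρ)⁻¹ ≤ 1 + 2 * ρ := by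
    rw [inv_le_iff_one_le_mul₀ hpos]
    nlinarith
  linarith

/-- Power mean inequality between the exponents `-1` and `2`, in tangent form. -/
lemma card_mul_sq_le_sum_sq {ι : Type*} [Fintype ι] {y : ι → ℝ} (hy : ∀ i, 0 < y i) {l : ℝ}
    (hl : 0 ≤ l) (h : l * ∑ i, (y i)⁻¹ ≤ Fintype.card ι) :
    Fintype.card ι * l ^ 2 ≤ ∑ i, y i ^ 2 := by
  have hi : ∀ i, 3 * l ^ 2 - 2 * l ^ 3 * (y i)⁻¹ ≤ y i ^ 2 := by
    intro i
    have hyi := hy i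
    have : y i ^ 2 - (3 * l ^ 2 - 2 * l ^ 3 * (y i)⁻¹) =
        (y i - l) ^ 2 * (y i + 2 * l) * (y i)⁻¹ := by
      field_simp
      ring
    have h' : 0 ≤ (y i - l) ^ 2 * (y i + 2 * l) * (y i)⁻¹ := by positivity
    linarith
  have hsum := Finset.sum_le_sum fun i (_ : i ∈ Finset.univ) => hi i
  rw [Finset.sum_sub_distrib, ← Finset.mul_sum _ _ (2 * l ^ 3)] at hsum
  simp only [Finset.sum_const, Finset.card_univ, nsmul_eq_mul] at hsum
  nlinarith [mul_le_mul_of_nonneg_left h (sq_nonneg l)]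

/-- sample complexity lower bound for a locally random `ρ`-replicable
algorithm for the multiple coin problem.  Coin `i` has bias `p i ~ Uniform[q-ε, q]`
(i.i.d.); conditionally on the biases, the two executions on coin `i` use independent
samples from `Ber(p i)^{m i}` and a shared seed `r_i ~ μ i`, everything independent
across coins, so the probability that all `N` outputs agree is the integral of the
product of the per-coin agreement probabilities.  If this is at least `1-ρ`, and each
`A i` is correct with probability `23/24` on biases `q-ε` (output `false`) and `q`
(output `true`), then `∑ m_i ≥ (2/6561)·N³q(1-q)/(ε²ρ²)`. -/
theorem stmt_4 (q ε ρ : ℝ) (hq : q ∈ Set.Ioo (1 / 2 : ℝ) 1)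
    (hε : ε ∈ Set.Ioo (0 : ℝ) (q - 1 / 2)) (hρ : ρ ∈ Set.Ioc (0 : ℝ) (1 / 2))
    (N : ℕ) (hN : 1 ≤ N) (m : Fin N → ℕ) (hm : ∀ i, 1 ≤ m i)
    (Ω : Fin N → Type) [∀ i, MeasurableSpace (Ω i)]
    (μ : ∀ i, Measure (Ω i)) [∀ i, IsProbabilityMeasure (μ i)]
    (A : ∀ i, (Fin (m i) → Bool) × Ω i → Bool) (hA : ∀ i, Measurable (A i))
    (hrep : 1 - ρ ≤
      ∫ p, ∏ i, ((((coinSeq (m i) (p i)).prod (coinSeq (m i) (p i))).prod (μ i))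
          {w | A i (w.1.1, w.2) = A i (w.1.2, w.2)}).toReal
        ∂(Measure.pi fun _ : Fin N => unifIcc (q - ε) q))
    (h0 : ∀ i, 23 / 24 ≤ (((coinSeq (m i) (q - ε)).prod (μ i)) {w | A i w = false}).toReal)
    (h1 : ∀ i, 23 / 24 ≤ (((coinSeq (m i) q).prod (μ i)) {w | A i w = true}).toReal) :
    (2 / 6561) * N ^ 3 * (q * (1 - q)) / (ε ^ 2 * ρ ^ 2) ≤ ∑ i, (m i : ℝ) := by
  have hε0 := hε.1
  have hρ0 := hρ.1
  have hq2 : 0 < q * (1 - q) := mul_pos (by linarith [hq.1]) (by linarith [hq.2])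
  have hmpos : ∀ i, (0 : ℝ) < m i := fun i => by exact_mod_cast hm i
  rw [integral_fintype_prod_eq_prod (fun i p =>
    ((((coinSeq (m i) p).prod (coinSeq (m i) p)).prod (μ i))
      {w | A i (w.1.1, w.2) = A i (w.1.2, w.2)}).toReal)] at hrep
  have hsum := sum_le_of_one_sub_le_prod Finset.univ hρ
    (fun i => integral_nonneg fun p => ENNReal.toReal_nonneg)
    (fun i => integral_agree_le hq hε (hm i) (μ i) (hA i) (h0 i) (h1 i)) hrep
  set s := √(q * (1 - q)) with hs
  have hs0 : 0 < s := Real.sqrt_pos.2 hq2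
  have hNpos : (0 : ℝ) < N := by exact_mod_cast hN
  have hterm : ∀ i, 7 / 24 * (√(q * (1 - q) / m i) / ε) = 7 / 24 * (s / ε) * (√(m i : ℝ))⁻¹ := by
    intro i
    rw [Real.sqrt_div hq2.le]
    ring
  simp only [hterm, ← Finset.mul_sum] at hsum
  have hmean := card_mul_sq_le_sum_sq (y := fun i => √(m i : ℝ))
    (fun i => Real.sqrt_pos.2 (hmpos i)) (l := N * (7 / 48) * s / (ε * ρ)) (by positivity) (by
      rw [Fintype.card_fin]
      calc N * (7 / 48) * s / (ε * ρ) * ∑ i, (√(m i : ℝ))⁻¹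
          = N / (2 * ρ) * (7 / 24 * (s / ε) * ∑ i, (√(m i : ℝ))⁻¹) := by
            field_simp
            ring
        _ ≤ N / (2 * ρ) * (2 * ρ) := by gcongr
        _ = N := by field_simp)
  simp only [Real.sq_sqrt (hmpos _).le, Fintype.card_fin] at hmean
  refine le_trans ?_ hmean
  have hs2 : s ^ 2 = q * (1 - q) := Real.sq_sqrt hq2.le
  rw [← hs2]
  have : (N : ℝ) * (N * (7 / 48) * s / (ε * ρ)) ^ 2 =
      (7 / 48) ^ 2 * N ^ 3 * s ^ 2 / (ε ^ 2 * ρ ^ 2) := by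
    field_simp
  rw [this]
  gcongr
  norm_num
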